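/- Let ν > 1, let φ, ψ ∈ ℝ, and let α be a Θ_ν-distributed complex random variable. Define Υ̃(ψ,α) = 2 Im(α e^{iψ}). Then: E[Υ(ψ,α)] = E[Υ̃(ψ,α)] = 0; E[Υ̃(ψ,α)Υ̃(φ,α)] = (4/(ν+1)) cos(ψ−φ); E[Υ̃(ψ,α)⁴] = 48/((ν+1)(ν+3)); E[|Υ(ψ,α) − Υ̃(ψ,α)|²] ≤ 16/((ν+1)(ν+3)); and E[|Υ(ψ,α)|²] ≤ 8/(ν+1). -/

import Mathlib

open MeasureTheory ProbabilityTheory Filter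

noncomputable section

/-- The Θ_ν distribution on ℂ: the measure on the open unit disk with density
`((ν−1)/(2π)) (1−|z|²)^{(ν−3)/2}` with respect to Lebesgue measure on ℂ. -/
def thetaDist (ν : ℝ) : Measure ℂ :=
  (volume.restrict {z : ℂ | ‖z‖ < 1}).withDensity
    (fun z => ENNReal.ofReal ((ν - 1) / (2 * Real.pi) * (1 - ‖z‖ ^ 2) ^ ((ν - 3) / 2)))

/-- `Υ(ψ,α) = −2 Im log(1 − α e^{iψ})`. -/
def Upsilon (ψ : ℝ) (α : ℂ) : ℝ :=
  -2 * (Complex.log (1 - α * Complex.exp (Complex.I * (ψ : ℂ)))).im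

/-- `Υ₁(ψ,α) = Υ(ψ,α) − Υ(0,α)`. -/
def Upsilon1 (ψ : ℝ) (α : ℂ) : ℝ := Upsilon ψ α - Upsilon 0 α

/-- The Prüfer phases: `ψ_0(θ) = 0`, `ψ_{k+1}(θ) = ψ_k(θ) + θ + Υ₁(ψ_k(θ), γ_k)`. -/
def prufer {Ω : Type*} (γ : ℕ → Ω → ℂ) (θ : ℝ) : ℕ → Ω → ℝ
  | 0 => fun _ => 0
  | k + 1 => fun ω => prufer γ θ k ω + θ + Upsilon1 (prufer γ θ k ω) (γ k ω)

/-- The characteristic function `a_k(λ) = E[e^{iλ(ψ_k(θ) − (k+1)θ)}]` of the Prüfer phases. -/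
def pruferChar {Ω : Type*} [MeasurableSpace Ω] (P : Measure Ω) (γ : ℕ → Ω → ℂ)
    (θ : ℝ) (k : ℕ) (l : ℝ) : ℂ :=
  ∫ ω, Complex.exp (Complex.I * ((l * (prufer γ θ k ω - (k + 1) * θ) : ℝ) : ℂ)) ∂P

/-- `Υ̃(ψ,α) = 2 Im(α e^{iψ})`. -/
def UpsilonTilde (ψ : ℝ) (α : ℂ) : ℝ :=
  2 * (α * Complex.exp (Complex.I * (ψ : ℂ))).im

lemma intervalIntegral_mul_one_sub_sq_rpow {s : ℝ} (hs : -1 < s) :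
    ∫ r in (0 : ℝ)..1, r * (1 - r ^ 2) ^ s = 1 / (2 * (s + 1)) := by
  have hs' : 0 < s + 1 := by linarith
  have hc : ContinuousOn (fun r : ℝ => -(1 - r ^ 2) ^ (s + 1) / (2 * (s + 1))) (Set.Icc 0 1) := by
    refine ContinuousOn.div_const (ContinuousOn.neg ?_) _
    exact ContinuousOn.rpow_const (by fun_prop) (fun x _ => Or.inr hs'.le)
  have hd : ∀ r ∈ Set.Ioo (0 : ℝ) 1,
      HasDerivAt (fun r : ℝ => -(1 - r ^ 2) ^ (s + 1) / (2 * (s + 1)))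
        (r * (1 - r ^ 2) ^ s) r := by
    intro r hr
    have h1 : 0 < 1 - r ^ 2 := by nlinarith [hr.1, hr.2]
    have h2 : HasDerivAt (fun r : ℝ => 1 - r ^ 2) (-(2 * r)) r := by
      simpa using (hasDerivAt_pow 2 r).const_sub 1
    have h3 := ((h2.rpow_const (p := s + 1) (Or.inl h1.ne')).neg).div_const (2 * (s + 1))
    refine h3.congr_deriv ?_
    rw [add_sub_cancel_right]
    field_simp
  have hi := intervalIntegral.integrableOn_deriv_of_nonneg hc hd (fun r hr =>
    mul_nonneg hr.1.le (Real.rpow_nonneg (by nlinarith [hr.1, hr.2]) _))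
  rw [intervalIntegral.integral_eq_sub_of_hasDerivAt_of_le zero_le_one hc hd
    ((intervalIntegrable_iff_integrableOn_Ioc_of_le zero_le_one).2 hi)]
  simp [Real.zero_rpow hs'.ne', neg_div]

lemma measurableSet_norm_lt_one : MeasurableSet {z : ℂ | ‖z‖ < 1} :=
  (isOpen_lt continuous_norm continuous_const).measurableSet

lemma integral_disk_one_sub_norm_sq_rpow {s : ℝ} (hs : -1 < s) :
    ∫ z in {z : ℂ | ‖z‖ < 1}, (1 - ‖z‖ ^ 2) ^ s = Real.pi / (s + 1) := by
  have hs' : 0 < s + 1 := by linarith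
  rw [← integral_indicator measurableSet_norm_lt_one]
  have h := integral_fun_norm_addHaar (volume : Measure ℂ)
    ((Set.Iio (1 : ℝ)).indicator (fun r => (1 - r ^ 2) ^ s))
  have e : ∀ z : ℂ, {z : ℂ | ‖z‖ < 1}.indicator (fun z => (1 - ‖z‖ ^ 2) ^ s) z
      = (Set.Iio (1 : ℝ)).indicator (fun r => (1 - r ^ 2) ^ s) ‖z‖ := fun z => by
    simp [Set.indicator_apply]
  simp_rw [e]
  rw [h]
  have e2 : ∫ r in Set.Ioi (0 : ℝ), r ^ (Module.finrank ℝ ℂ - 1) •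
      (Set.Iio (1 : ℝ)).indicator (fun r => (1 - r ^ 2) ^ s) r = 1 / (2 * (s + 1)) := by
    rw [← intervalIntegral_mul_one_sub_sq_rpow hs, intervalIntegral.integral_of_le zero_le_one,
      integral_Ioc_eq_integral_Ioo, ← Set.Ioi_inter_Iio, ← setIntegral_indicator measurableSet_Iio]
    congr 1
    ext r
    simp [Set.indicator_apply]
  rw [e2]
  simp [Measure.real, Complex.volume_ball]
  field_simp

lemma integral_thetaDist {E : Type*} [NormedAddCommGroup E] [NormedSpace ℝ E] {ν : ℝ}
    (hν : 1 < ν) (f : ℂ → E) :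
    ∫ z, f z ∂thetaDist ν = ∫ z in {z : ℂ | ‖z‖ < 1},
      ((ν - 1) / (2 * Real.pi) * (1 - ‖z‖ ^ 2) ^ ((ν - 3) / 2)) • f z := by
  rw [thetaDist, integral_withDensity_eq_integral_toReal_smul (by fun_prop)
    (Eventually.of_forall fun _ => ENNReal.ofReal_lt_top)]
  refine setIntegral_congr_fun measurableSet_norm_lt_one fun z (hz : ‖z‖ < 1) => ?_
  have h0 : 0 ≤ 1 - ‖z‖ ^ 2 := by nlinarith [norm_nonneg z]
  have h1 : 0 ≤ ν - 1 := by linarith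
  rw [ENNReal.toReal_ofReal (by positivity)]

lemma ae_norm_lt_one_thetaDist (ν : ℝ) : ∀ᵐ z ∂thetaDist ν, ‖z‖ < 1 :=
  (withDensity_absolutelyContinuous _ _).ae_le
    (ae_restrict_mem measurableSet_norm_lt_one)

/-- The moments of `1 - |α|²` under `Θ_ν`. -/
lemma integral_one_sub_norm_sq_pow {ν : ℝ} (hν : 1 < ν) (k : ℕ) :
    ∫ z, (1 - ‖z‖ ^ 2) ^ k ∂thetaDist ν = (ν - 1) / (ν - 1 + 2 * k) := by
  have hk : (0 : ℝ) ≤ k := k.cast_nonneg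
  rw [integral_thetaDist hν]
  have e : ∫ z in {z : ℂ | ‖z‖ < 1},
      ((ν - 1) / (2 * Real.pi) * (1 - ‖z‖ ^ 2) ^ ((ν - 3) / 2)) • (1 - ‖z‖ ^ 2) ^ k
      = ∫ z in {z : ℂ | ‖z‖ < 1},
      ((ν - 1) / (2 * Real.pi)) * (1 - ‖z‖ ^ 2) ^ ((ν - 3) / 2 + k) := by
    refine setIntegral_congr_fun measurableSet_norm_lt_one fun z (hz : ‖z‖ < 1) => ?_
    have h0 : 0 < 1 - ‖z‖ ^ 2 := by nlinarith [norm_nonneg z]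
    simp only [smul_eq_mul]
    rw [Real.rpow_add_natCast h0.ne', mul_assoc]
  rw [e, integral_const_mul, integral_disk_one_sub_norm_sq_rpow (by linarith)]
  have h1 : ν - 1 + 2 * k ≠ 0 := by linarith
  rw [show (ν - 3) / 2 + k + 1 = (ν - 1 + 2 * k) / 2 by ring]
  field_simp

lemma isProbabilityMeasure_thetaDist {ν : ℝ} (hν : 1 < ν) :
    IsProbabilityMeasure (thetaDist ν) := by
  have h := integral_one_sub_norm_sq_pow hν 0
  have h1 : ν - 1 ≠ 0 := by linarith
  simp [h1, Measure.real] at h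
  exact ⟨(ENNReal.toReal_eq_one_iff _).1 h⟩

lemma measurePreserving_thetaDist (ν : ℝ) (L : ℂ ≃ₗᵢ[ℝ] ℂ) :
    MeasurePreserving L (thetaDist ν) (thetaDist ν) := by
  refine ⟨L.continuous.measurable, ?_⟩
  ext s hs
  have hs' : MeasurableSet (L ⁻¹' s) := L.continuous.measurable hs
  rw [Measure.map_apply L.continuous.measurable hs, thetaDist, withDensity_apply _ hs',
    withDensity_apply _ hs, Measure.restrict_restrict hs', Measure.restrict_restrict hs,
    ← L.measurePreserving.setLIntegral_comp_preimage_emb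
      L.toHomeomorph.measurableEmbedding _ (s ∩ _)]
  simp [Set.preimage_inter]

lemma integral_thetaDist_comp {E : Type*} [NormedAddCommGroup E] [NormedSpace ℝ E] (ν : ℝ)
    (L : ℂ ≃ₗᵢ[ℝ] ℂ) (f : ℂ → E) : ∫ z, f (L z) ∂thetaDist ν = ∫ z, f z ∂thetaDist ν :=
  (measurePreserving_thetaDist ν L).integral_comp L.toHomeomorph.measurableEmbedding f

lemma integrable_thetaDist {E : Type*} [NormedAddCommGroup E] [SecondCountableTopology E]
    {ν : ℝ} (hν : 1 < ν) {f : ℂ → E} (hf : Continuous f) : Integrable f (thetaDist ν) := by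
  have := isProbabilityMeasure_thetaDist hν
  obtain ⟨C, hC⟩ := (isCompact_closedBall (0 : ℂ) 1).exists_bound_of_continuousOn hf.continuousOn
  refine Integrable.of_bound hf.aestronglyMeasurable C ?_
  filter_upwards [ae_norm_lt_one_thetaDist ν] with z hz
  exact hC z (by simpa using hz.le)

lemma integral_norm_sq_thetaDist {ν : ℝ} (hν : 1 < ν) :
    ∫ z, ‖z‖ ^ 2 ∂thetaDist ν = 2 / (ν + 1) := by
  have := isProbabilityMeasure_thetaDist hν
  have h := integral_one_sub_norm_sq_pow hν 1
  simp only [pow_one] at h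
  rw [integral_sub (integrable_const _) (integrable_thetaDist hν (by fun_prop))] at h
  simp only [integral_const, probReal_univ, smul_eq_mul, Nat.cast_one] at h
  have h1 : ν + 1 ≠ 0 := by linarith
  have h2 : ν - 1 + 2 * 1 ≠ 0 := by linarith
  rw [eq_div_iff h2] at h
  rw [eq_div_iff h1]
  linarith

lemma integral_norm_pow_four_thetaDist {ν : ℝ} (hν : 1 < ν) :
    ∫ z, ‖z‖ ^ 4 ∂thetaDist ν = 8 / ((ν + 1) * (ν + 3)) := by
  have := isProbabilityMeasure_thetaDist hν
  have h := integral_one_sub_norm_sq_pow hν 2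
  have e : ∀ z : ℂ, (1 - ‖z‖ ^ 2) ^ 2 = (1 - 2 * ‖z‖ ^ 2) + ‖z‖ ^ 4 := fun z => by ring
  simp_rw [e] at h
  rw [integral_add (integrable_thetaDist hν (by fun_prop)) (integrable_thetaDist hν (by fun_prop)),
    integral_sub (integrable_const _) (integrable_thetaDist hν (by fun_prop)),
    integral_const_mul, integral_norm_sq_thetaDist hν] at h
  simp only [integral_const, probReal_univ, smul_eq_mul, Nat.cast_ofNat] at h
  have h1 : ν + 1 ≠ 0 := by linarith
  have h3 : ν + 3 ≠ 0 := by linarith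
  rw [show ν - 1 + 2 * 2 = ν + 3 by ring] at h
  rw [← sub_eq_zero] at h
  rw [← sub_eq_zero, ← h]
  field_simp
  ring

lemma integral_pow_mul_conj_pow_thetaDist (ν : ℝ) {j k : ℕ} (hjk : j ≠ k) :
    ∫ z, z ^ j * (starRingEnd ℂ z) ^ k ∂thetaDist ν = 0 := by
  have hd : ((j : ℝ) - k) ≠ 0 := sub_ne_zero.2 (by exact_mod_cast hjk)
  set u : Circle := Circle.exp (Real.pi / ((j : ℝ) - k)) with hu
  have hc : (u : ℂ) ^ j * (starRingEnd ℂ (u : ℂ)) ^ k = -1 := by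
    rw [← Circle.coe_inv_eq_conj, hu, ← Circle.exp_neg, Circle.coe_exp, Circle.coe_exp,
      ← Complex.exp_nat_mul, ← Complex.exp_nat_mul, ← Complex.exp_add, ← Complex.exp_pi_mul_I]
    congr 1
    have hd' : ((j : ℂ) - k) ≠ 0 := by exact_mod_cast hd
    push_cast
    field_simp
    ring
  have h := integral_thetaDist_comp ν (rotation u) (fun z => z ^ j * (starRingEnd ℂ z) ^ k)
  have e : ∀ z : ℂ, (rotation u z) ^ j * (starRingEnd ℂ (rotation u z)) ^ k
      = - (z ^ j * (starRingEnd ℂ z) ^ k) := fun z => by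
    rw [rotation_apply, map_mul, mul_pow, mul_pow, mul_mul_mul_comm, hc, neg_one_mul]
  simp_rw [e] at h
  rw [integral_neg] at h
  exact self_eq_neg.1 h.symm

lemma integral_complex_re {X : Type*} [MeasurableSpace X] {μ : Measure X} {f : X → ℂ}
    (hf : Integrable f μ) : ∫ x, (f x).re ∂μ = (∫ x, f x ∂μ).re :=
  integral_re hf

lemma integral_im_mul_im_thetaDist {ν : ℝ} (hν : 1 < ν) (a b : ℂ) {j k : ℕ} (hj : j ≠ 0) :
    ∫ z, (a * z ^ j).im * (b * z ^ k).im ∂thetaDist ν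
      = if j = k then (a * starRingEnd ℂ b).re / 2 * ∫ z, ‖z‖ ^ (2 * k) ∂thetaDist ν else 0 := by
  have e : ∀ z : ℂ, (a * z ^ j).im * (b * z ^ k).im
      = (a * starRingEnd ℂ b / 2 * (z ^ j * (starRingEnd ℂ z) ^ k)
        - a * b / 2 * (z ^ (j + k) * (starRingEnd ℂ z) ^ 0)).re := fun z => by
    have h : a * starRingEnd ℂ b / 2 * (z ^ j * (starRingEnd ℂ z) ^ k)
        - a * b / 2 * (z ^ (j + k) * (starRingEnd ℂ z) ^ 0)
        = ((a * z ^ j) * starRingEnd ℂ (b * z ^ k) - (a * z ^ j) * (b * z ^ k))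
          * ((1 / 2 : ℝ) : ℂ) := by
      simp only [map_mul, map_pow]
      push_cast
      ring
    rw [h, Complex.re_mul_ofReal]
    simp only [Complex.sub_re, Complex.mul_re, Complex.conj_re, Complex.conj_im]
    ring
  have hi : ∀ m n : ℕ, Integrable (fun z : ℂ => z ^ m * (starRingEnd ℂ z) ^ n) (thetaDist ν) :=
    fun m n => integrable_thetaDist hν (by fun_prop)
  have hi' : Integrable (fun z : ℂ => a * starRingEnd ℂ b / 2 * (z ^ j * (starRingEnd ℂ z) ^ k)
      - a * b / 2 * (z ^ (j + k) * (starRingEnd ℂ z) ^ 0)) (thetaDist ν) :=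
    ((hi j k).const_mul _).sub ((hi (j + k) 0).const_mul _)
  simp_rw [e]
  rw [integral_complex_re hi', integral_sub ((hi j k).const_mul _)
    ((hi (j + k) 0).const_mul _), integral_const_mul,
    integral_const_mul, integral_pow_mul_conj_pow_thetaDist ν (by omega : j + k ≠ 0)]
  split_ifs with hjk
  · subst hjk
    have e2 : ∀ z : ℂ, z ^ j * (starRingEnd ℂ z) ^ j = ((‖z‖ ^ (2 * j) : ℝ) : ℂ) := fun z => by
      rw [← mul_pow, Complex.mul_conj, Complex.normSq_eq_norm_sq, pow_mul]
      push_cast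
      rfl
    simp_rw [e2]
    rw [integral_complex_ofReal, mul_zero, sub_zero, Complex.re_mul_ofReal,
      Complex.div_ofNat_re]
  · rw [integral_pow_mul_conj_pow_thetaDist ν hjk]
    simp

lemma integral_im_pow_four_thetaDist {ν : ℝ} (hν : 1 < ν) :
    ∫ z, z.im ^ 4 ∂thetaDist ν = 3 / ((ν + 1) * (ν + 3)) := by
  have e : ∀ z : ℂ, z.im ^ 4 = 3 / 8 * ‖z‖ ^ 4 + (1 / 8 * (z ^ 4 * (starRingEnd ℂ z) ^ 0)
      - 1 / 2 * (z ^ 3 * (starRingEnd ℂ z) ^ 1)).re := fun z => by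
    rw [show ‖z‖ ^ 4 = (‖z‖ ^ 2) ^ 2 by ring, ← Complex.normSq_eq_norm_sq, Complex.normSq_apply]
    have h : 1 / 8 * (z ^ 4 * (starRingEnd ℂ z) ^ 0) - 1 / 2 * (z ^ 3 * (starRingEnd ℂ z) ^ 1)
        = (z * z * (z * z) - 4 * (z * z) * (z * starRingEnd ℂ z)) * ((1 / 8 : ℝ) : ℂ) := by
      push_cast
      ring
    rw [h, Complex.re_mul_ofReal]
    simp
    ring
  have hi : ∀ m n : ℕ, Integrable (fun z : ℂ => z ^ m * (starRingEnd ℂ z) ^ n) (thetaDist ν) :=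
    fun m n => integrable_thetaDist hν (by fun_prop)
  have hi' : Integrable (fun z : ℂ => 1 / 8 * (z ^ 4 * (starRingEnd ℂ z) ^ 0)
      - 1 / 2 * (z ^ 3 * (starRingEnd ℂ z) ^ 1)) (thetaDist ν) :=
    ((hi 4 0).const_mul (1 / 8)).sub ((hi 3 1).const_mul (1 / 2))
  simp_rw [e]
  rw [integral_add (integrable_thetaDist hν (by fun_prop))
    (integrable_thetaDist hν (by fun_prop)), integral_const_mul,
    integral_norm_pow_four_thetaDist hν, integral_complex_re hi',
    integral_sub ((hi 4 0).const_mul _) ((hi 3 1).const_mul _), integral_const_mul,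
    integral_const_mul, integral_pow_mul_conj_pow_thetaDist ν (by norm_num),
    integral_pow_mul_conj_pow_thetaDist ν (by norm_num)]
  simp
  ring

lemma integral_norm_pow_antitone {ν : ℝ} (hν : 1 < ν) {m n : ℕ} (h : m ≤ n) :
    ∫ z, ‖z‖ ^ n ∂thetaDist ν ≤ ∫ z, ‖z‖ ^ m ∂thetaDist ν := by
  refine integral_mono_ae (integrable_thetaDist hν (by fun_prop))
    (integrable_thetaDist hν (by fun_prop)) ?_
  filter_upwards [ae_norm_lt_one_thetaDist ν] with z hz
  exact pow_le_pow_of_le_one (norm_nonneg z) hz.le h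

lemma integral_sum_sq_le {ν : ℝ} (hν : 1 < ν) (m n : ℕ) :
    ∫ z, (∑ k ∈ Finset.Ioo m n, 2 * (z ^ k / (k : ℂ)).im) ^ 2 ∂thetaDist ν
      ≤ 4 / (m + 1) * ∫ z, ‖z‖ ^ (2 * (m + 1)) ∂thetaDist ν := by
  have e : ∀ z : ℂ, (∑ k ∈ Finset.Ioo m n, 2 * (z ^ k / (k : ℂ)).im) ^ 2
      = ∑ j ∈ Finset.Ioo m n, ∑ k ∈ Finset.Ioo m n,
        4 * (((j : ℂ)⁻¹ * z ^ j).im * ((k : ℂ)⁻¹ * z ^ k).im) := fun z => by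
    rw [sq, Finset.sum_mul_sum]
    refine Finset.sum_congr rfl fun j _ => Finset.sum_congr rfl fun k _ => ?_
    rw [div_eq_inv_mul, div_eq_inv_mul]
    ring
  have hi : ∀ j k : ℕ, Integrable
      (fun z : ℂ => 4 * (((j : ℂ)⁻¹ * z ^ j).im * ((k : ℂ)⁻¹ * z ^ k).im)) (thetaDist ν) :=
    fun j k => integrable_thetaDist hν (by fun_prop)
  simp_rw [e]
  rw [integral_finsetSum _ fun j _ => integrable_finsetSum _ fun k _ => hi j k]
  calc _ = ∑ j ∈ Finset.Ioo m n, 2 * ((j : ℝ) ^ 2)⁻¹ * ∫ z, ‖z‖ ^ (2 * j) ∂thetaDist ν := by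
        refine Finset.sum_congr rfl fun j hj => ?_
        rw [integral_finsetSum _ fun k _ => hi j k]
        have hj0 : j ≠ 0 := by have := (Finset.mem_Ioo.1 hj).1; omega
        simp_rw [integral_const_mul, integral_im_mul_im_thetaDist hν _ _ hj0]
        rw [← Finset.mul_sum, Finset.sum_ite_eq, if_pos hj]
        have h : ((j : ℂ)⁻¹ * starRingEnd ℂ (j : ℂ)⁻¹).re = ((j : ℝ) ^ 2)⁻¹ := by
          rw [Complex.mul_conj, Complex.ofReal_re, Complex.normSq_inv, Complex.normSq_natCast, sq]
        rw [h]
        ring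
    _ ≤ ∑ j ∈ Finset.Ioo m n, 2 * ((j : ℝ) ^ 2)⁻¹ * ∫ z, ‖z‖ ^ (2 * (m + 1)) ∂thetaDist ν := by
        refine Finset.sum_le_sum fun j hj => mul_le_mul_of_nonneg_left ?_ (by positivity)
        have := (Finset.mem_Ioo.1 hj).1
        exact integral_norm_pow_antitone hν (by omega)
    _ = 2 * (∑ j ∈ Finset.Ioo m n, ((j : ℝ) ^ 2)⁻¹) * ∫ z, ‖z‖ ^ (2 * (m + 1)) ∂thetaDist ν := by
        rw [← Finset.sum_mul, ← Finset.mul_sum]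
    _ ≤ 2 * (2 / (m + 1)) * ∫ z, ‖z‖ ^ (2 * (m + 1)) ∂thetaDist ν := by
        refine mul_le_mul_of_nonneg_right ?_ (integral_nonneg fun z => by positivity)
        exact mul_le_mul_of_nonneg_left (sum_Ioo_inv_sq_le m n) zero_le_two
    _ = _ := by ring

/-- Fatou's lemma for the second moment of an almost everywhere limit. -/
lemma integral_sq_le_of_tendsto {X : Type*} [MeasurableSpace X] {μ : Measure X}
    {F : ℕ → X → ℝ} {G : X → ℝ} {C : ℝ} (hF : ∀ n, Measurable (F n)) (hG : Measurable G)
    (hi : ∀ n, Integrable (fun x => F n x ^ 2) μ) (hC : ∀ n, ∫ x, F n x ^ 2 ∂μ ≤ C)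
    (hlim : ∀ᵐ x ∂μ, Tendsto (fun n => F n x) atTop (nhds (G x))) :
    ∫ x, G x ^ 2 ∂μ ≤ C := by
  have hC0 : 0 ≤ C := (integral_nonneg fun x => sq_nonneg (F 0 x)).trans (hC 0)
  rw [integral_eq_lintegral_of_nonneg_ae (Eventually.of_forall fun x => sq_nonneg (G x))
    (hG.pow_const 2).aestronglyMeasurable]
  refine ENNReal.toReal_le_of_le_ofReal hC0 ?_
  calc ∫⁻ x, ENNReal.ofReal (G x ^ 2) ∂μ
      = ∫⁻ x, liminf (fun n => ENNReal.ofReal (F n x ^ 2)) atTop ∂μ := by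
        refine lintegral_congr_ae ?_
        filter_upwards [hlim] with x hx
        exact (ENNReal.tendsto_ofReal (hx.pow 2)).liminf_eq.symm
    _ ≤ liminf (fun n => ∫⁻ x, ENNReal.ofReal (F n x ^ 2) ∂μ) atTop :=
        lintegral_liminf_le fun n => ((hF n).pow_const 2).ennreal_ofReal
    _ ≤ ENNReal.ofReal C := by
        refine liminf_le_of_le (by isBoundedDefault) fun b hb => ?_
        obtain ⟨n, hn⟩ := hb.exists
        refine hn.trans ?_
        rw [← ofReal_integral_eq_lintegral_ofReal (hi n)
          (Eventually.of_forall fun x => sq_nonneg (F n x))]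
        exact ENNReal.ofReal_le_ofReal (hC n)

lemma measurable_Upsilon (ψ : ℝ) : Measurable (Upsilon ψ) := by
  unfold Upsilon
  exact (Complex.measurable_im.comp (Complex.measurable_log.comp (by fun_prop))).const_mul _

lemma continuous_UpsilonTilde (ψ : ℝ) : Continuous (UpsilonTilde ψ) := by
  unfold UpsilonTilde
  fun_prop

lemma rotation_exp (ψ : ℝ) (z : ℂ) :
    rotation (Circle.exp ψ) z = z * Complex.exp (Complex.I * (ψ : ℂ)) := by
  rw [rotation_apply, Circle.coe_exp, mul_comm, mul_comm (ψ : ℂ)]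

lemma Upsilon_eq_rotation (ψ : ℝ) (z : ℂ) :
    Upsilon ψ z = Upsilon 0 (rotation (Circle.exp ψ) z) := by
  rw [rotation_exp]
  simp [Upsilon]

lemma UpsilonTilde_eq_rotation (ψ : ℝ) (z : ℂ) :
    UpsilonTilde ψ z = UpsilonTilde 0 (rotation (Circle.exp ψ) z) := by
  rw [rotation_exp]
  simp [UpsilonTilde]

lemma hasSum_Upsilon_zero {z : ℂ} (hz : ‖z‖ < 1) :
    HasSum (fun k : ℕ => 2 * (z ^ k / (k : ℂ)).im) (Upsilon 0 z) := by
  have h := (Complex.hasSum_im (Complex.hasSum_taylorSeries_neg_log hz)).mul_left 2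
  have e : Upsilon 0 z = 2 * (-Complex.log (1 - z)).im := by simp [Upsilon]
  rwa [e]

lemma integral_Upsilon_sub_sum_sq_le {ν : ℝ} (hν : 1 < ν) (m : ℕ) :
    ∫ z, (Upsilon 0 z - ∑ k ∈ Finset.range (m + 1), 2 * (z ^ k / (k : ℂ)).im) ^ 2 ∂thetaDist ν
      ≤ 4 / (m + 1) * ∫ z, ‖z‖ ^ (2 * (m + 1)) ∂thetaDist ν := by
  refine integral_sq_le_of_tendsto
    (F := fun n z => ∑ k ∈ Finset.Ioo m n, 2 * (z ^ k / (k : ℂ)).im) (fun n => ?_) ?_ (fun n => ?_)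
    (fun n => integral_sum_sq_le hν m n) ?_
  · fun_prop
  · exact (measurable_Upsilon 0).sub (by fun_prop)
  · exact integrable_thetaDist hν (by fun_prop)
  · filter_upwards [ae_norm_lt_one_thetaDist ν] with z hz
    refine ((hasSum_Upsilon_zero hz).tendsto_sum_nat.sub_const _).congr' ?_
    filter_upwards [eventually_ge_atTop (m + 1)] with n hn
    rw [← Finset.sum_Ico_eq_sub _ hn]
    rfl

lemma Upsilon_zero_conj {z : ℂ} (hz : ‖z‖ < 1) :
    Upsilon 0 (starRingEnd ℂ z) = -Upsilon 0 z := by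
  have h : (1 - z).arg ≠ Real.pi := by
    have hre : 0 < (1 - z).re := by
      have := (Complex.re_le_norm z).trans_lt hz
      simpa using this
    have := (abs_lt.1 (Complex.abs_arg_lt_pi_div_two_iff.2 (Or.inl hre))).2
    linarith [Real.pi_pos]
  have h2 := Complex.log_conj _ h
  rw [map_sub, map_one] at h2
  simp [Upsilon, h2]

lemma integral_Upsilon (ν ψ : ℝ) : ∫ z, Upsilon ψ z ∂thetaDist ν = 0 := by
  simp_rw [Upsilon_eq_rotation ψ]
  rw [integral_thetaDist_comp ν _ (Upsilon 0)]
  have h := integral_thetaDist_comp ν Complex.conjLIE (Upsilon 0)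
  have e : ∫ z, Upsilon 0 (Complex.conjLIE z) ∂thetaDist ν = ∫ z, -Upsilon 0 z ∂thetaDist ν := by
    refine integral_congr_ae ?_
    filter_upwards [ae_norm_lt_one_thetaDist ν] with z hz
    exact Upsilon_zero_conj hz
  rw [e, integral_neg] at h
  exact self_eq_neg.1 h.symm

lemma integral_UpsilonTilde (ν ψ : ℝ) : ∫ z, UpsilonTilde ψ z ∂thetaDist ν = 0 := by
  have h := integral_thetaDist_comp ν (LinearIsometryEquiv.neg ℝ) (UpsilonTilde ψ)
  have e : ∀ z, UpsilonTilde ψ (LinearIsometryEquiv.neg ℝ z) = -UpsilonTilde ψ z := fun z => by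
    simp [UpsilonTilde]
    ring
  simp_rw [e] at h
  rw [integral_neg] at h
  exact self_eq_neg.1 h.symm

lemma integral_UpsilonTilde_mul {ν : ℝ} (hν : 1 < ν) (ψ φ : ℝ) :
    ∫ z, UpsilonTilde ψ z * UpsilonTilde φ z ∂thetaDist ν = 4 / (ν + 1) * Real.cos (ψ - φ) := by
  have e : ∀ z, UpsilonTilde ψ z * UpsilonTilde φ z
      = 4 * ((Complex.exp (Complex.I * (ψ : ℂ)) * z ^ 1).im
        * (Complex.exp (Complex.I * (φ : ℂ)) * z ^ 1).im) := fun z => by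
    rw [UpsilonTilde, UpsilonTilde, pow_one, mul_comm z, mul_comm z]
    ring
  simp_rw [e]
  rw [integral_const_mul, integral_im_mul_im_thetaDist hν _ _ one_ne_zero, if_pos rfl, mul_one,
    integral_norm_sq_thetaDist hν, ← Complex.exp_conj, ← Complex.exp_add]
  have h : Complex.I * (ψ : ℂ) + starRingEnd ℂ (Complex.I * (φ : ℂ))
      = ((ψ - φ : ℝ) : ℂ) * Complex.I := by
    simp
    ring
  rw [h, Complex.exp_ofReal_mul_I_re]
  ring

lemma integral_UpsilonTilde_pow_four {ν : ℝ} (hν : 1 < ν) (ψ : ℝ) :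
    ∫ z, UpsilonTilde ψ z ^ 4 ∂thetaDist ν = 48 / ((ν + 1) * (ν + 3)) := by
  simp_rw [UpsilonTilde_eq_rotation ψ]
  rw [integral_thetaDist_comp ν _ fun z => UpsilonTilde 0 z ^ 4]
  simp only [UpsilonTilde, Complex.ofReal_zero, mul_zero, Complex.exp_zero, mul_one, mul_pow]
  rw [integral_const_mul, integral_im_pow_four_thetaDist hν]
  ring

lemma integral_Upsilon_sub_UpsilonTilde_sq_le {ν : ℝ} (hν : 1 < ν) (ψ : ℝ) :
    ∫ z, (Upsilon ψ z - UpsilonTilde ψ z) ^ 2 ∂thetaDist ν ≤ 16 / ((ν + 1) * (ν + 3)) := by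
  simp_rw [UpsilonTilde_eq_rotation ψ, Upsilon_eq_rotation ψ]
  rw [integral_thetaDist_comp ν _ fun z => (Upsilon 0 z - UpsilonTilde 0 z) ^ 2]
  have h := integral_Upsilon_sub_sum_sq_le hν 1
  norm_num [Finset.sum_range_succ, integral_norm_pow_four_thetaDist hν] at h
  simp only [UpsilonTilde, Complex.ofReal_zero, mul_zero, Complex.exp_zero, mul_one]
  refine h.trans_eq ?_
  ring

lemma integral_Upsilon_sq_le {ν : ℝ} (hν : 1 < ν) (ψ : ℝ) :
    ∫ z, Upsilon ψ z ^ 2 ∂thetaDist ν ≤ 8 / (ν + 1) := by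
  simp_rw [Upsilon_eq_rotation ψ]
  rw [integral_thetaDist_comp ν _ fun z => Upsilon 0 z ^ 2]
  have h := integral_Upsilon_sub_sum_sq_le hν 0
  norm_num [integral_norm_sq_thetaDist hν] at h
  refine h.trans_eq ?_
  ring

/-- Moment identities and estimates for `Υ` and `Υ̃` when `α ∼ Θ_ν`:
`E[Υ(ψ,α)] = E[Υ̃(ψ,α)] = 0`, `E[Υ̃(ψ,α)Υ̃(φ,α)] = (4/(ν+1))cos(ψ−φ)`,
`E[Υ̃(ψ,α)⁴] = 48/((ν+1)(ν+3))`, `E[|Υ(ψ,α)−Υ̃(ψ,α)|²] ≤ 16/((ν+1)(ν+3))`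
and `E[|Υ(ψ,α)|²] ≤ 8/(ν+1)`. -/
theorem upsilon_moments (ν : ℝ) (hν : 1 < ν) (ψ φ : ℝ)
    {Ω : Type*} [MeasurableSpace Ω] (P : Measure Ω) [IsProbabilityMeasure P]
    (α : Ω → ℂ) (hlaw : Measure.map α P = thetaDist ν) :
    (∫ ω, Upsilon ψ (α ω) ∂P) = 0 ∧
    (∫ ω, UpsilonTilde ψ (α ω) ∂P) = 0 ∧
    (∫ ω, UpsilonTilde ψ (α ω) * UpsilonTilde φ (α ω) ∂P)
      = (4 / (ν + 1)) * Real.cos (ψ - φ) ∧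
    (∫ ω, (UpsilonTilde ψ (α ω)) ^ 4 ∂P) = 48 / ((ν + 1) * (ν + 3)) ∧
    (∫ ω, (Upsilon ψ (α ω) - UpsilonTilde ψ (α ω)) ^ 2 ∂P) ≤ 16 / ((ν + 1) * (ν + 3)) ∧
    (∫ ω, (Upsilon ψ (α ω)) ^ 2 ∂P) ≤ 8 / (ν + 1) := by
  have hprob := isProbabilityMeasure_thetaDist hν
  have hα : AEMeasurable α P :=
    AEMeasurable.of_map_ne_zero (hlaw ▸ hprob.ne_zero)
  have integral_comp_α : ∀ f : ℂ → ℝ, Measurable f →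
      ∫ ω, f (α ω) ∂P = ∫ z, f z ∂thetaDist ν := fun f hf => by
    rw [← hlaw, integral_map hα hf.aestronglyMeasurable]
  have hU := measurable_Upsilon ψ
  have hT := fun θ => (continuous_UpsilonTilde θ).measurable
  rw [integral_comp_α _ hU, integral_comp_α _ (hT ψ),
    integral_comp_α (fun z => UpsilonTilde ψ z * UpsilonTilde φ z) ((hT ψ).mul (hT φ)),
    integral_comp_α (fun z => UpsilonTilde ψ z ^ 4) ((hT ψ).pow_const 4),
    integral_comp_α (fun z => (Upsilon ψ z - UpsilonTilde ψ z) ^ 2) ((hU.sub (hT ψ)).pow_const 2),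
    integral_comp_α (fun z => Upsilon ψ z ^ 2) (hU.pow_const 2)]
  exact ⟨integral_Upsilon ν ψ, integral_UpsilonTilde ν ψ, integral_UpsilonTilde_mul hν ψ φ,
    integral_UpsilonTilde_pow_four hν ψ, integral_Upsilon_sub_UpsilonTilde_sq_le hν ψ,
    integral_Upsilon_sq_le hν ψ⟩
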